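/- Let R be a commutative Noetherian ring that is Iwanaga–Gorenstein, i.e. R has finite injective dimension as a module over itself. Then for an R-module D, the following are equivalent: (i) Ext^1_R(G, D) = 0 for every Gorenstein flat R-module G; (ii) D is cotorsion and has finite injective dimension. -/

import Mathlib

/-!
STATEMENT 17: Let `R` be a commutative Noetherian ring which is Iwanaga–Gorenstein (i.e. `R`
has finite injective dimension as a module over itself).  Then for an `R`-module `D`, one has
`Ext¹_R(G, D) = 0` for every Gorenstein flat `R`-module `G` if and only if `D` is cotorsion
and has finite injective dimension.

The vanishing of the (Yoneda) group `Ext¹(A, B)` is expressed by the (equivalent)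
statement that every short exact sequence `0 → B → E → A → 0` splits.
-/

universe u

open CategoryTheory MonoidalCategory Limits

/-- Vanishing of (Yoneda) `Ext¹(A, B)` in an abelian category: every short exact
sequence `0 → B → E → A → 0` splits. -/
def Ext1Vanishes {C : Type*} [Category C] [Abelian C] (A B : C) : Prop :=
  ∀ (E : C) (f : B ⟶ E) (g : E ⟶ A) (w : f ≫ g = 0),
    (ShortComplex.mk f g w).ShortExact → ∃ s : A ⟶ E, s ≫ g = 𝟙 A

variable {R : Type u} [CommRing R]

/-- An `R`-module `M` is cotorsion if `Ext¹_R(F, M) = 0` for every flat `R`-module `F`. -/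
def IsCotorsionModule (M : ModuleCat.{u} R) : Prop :=
  ∀ F : ModuleCat.{u} R, Module.Flat R F → Ext1Vanishes F M

/-- A chain complex `F` of `R`-modules is an F-totally acyclic complex of flats if all its
components are flat, it is acyclic, and `I ⊗[R] F` is acyclic for every injective
`R`-module `I`. -/
def FTotallyAcyclic (F : ChainComplex (ModuleCat.{u} R) ℤ) : Prop :=
  (∀ n, Module.Flat R (F.X n)) ∧ (∀ n, F.ExactAt n) ∧
    ∀ I : ModuleCat.{u} R, Module.Injective R I →
      ∀ n, (((tensorLeft I).mapHomologicalComplex (ComplexShape.down ℤ)).obj F).ExactAt n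

/-- An `R`-module is Gorenstein flat if it is isomorphic to `Z₀ F` for some F-totally
acyclic complex of flats `F`. -/
def IsGorensteinFlat (G : ModuleCat.{u} R) : Prop :=
  ∃ F : ChainComplex (ModuleCat.{u} R) ℤ, FTotallyAcyclic F ∧ Nonempty (G ≅ F.cycles 0)

/-- An `R`-module `M` has finite injective dimension if there is an exact coresolution
`0 → M → J⁰ → J¹ → ⋯ → Jⁿ → 0` by injective modules. -/
def HasFiniteInjectiveDimension (M : ModuleCat.{u} R) : Prop :=
  ∃ (n : ℕ) (J : CochainComplex (ModuleCat.{u} R) ℕ) (ι : M ⟶ J.X 0),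
    (∀ i, Module.Injective R (J.X i)) ∧ (∀ i, n < i → IsZero (J.X i)) ∧
    Mono ι ∧ ∃ w : ι ≫ J.d 0 1 = 0,
      (ShortComplex.mk ι (J.d 0 1) w).Exact ∧
      ∀ i, (ShortComplex.mk (J.d i (i + 1)) (J.d (i + 1) (i + 2))
        (J.d_comp_d i (i + 1) (i + 2))).Exact

section

open Abelian

section ExtDimensionShift

variable {C : Type*} [Category C] [Abelian C] [HasExt.{u} C] {S : ShortComplex C}

lemma subsingleton_ext_X₁_of_shortExact (hS : S.ShortExact) (Y : C) (n : ℕ)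
    (h₂ : Subsingleton (Ext.{u} S.X₂ Y n)) (h₃ : Subsingleton (Ext.{u} S.X₃ Y (n + 1))) :
    Subsingleton (Ext.{u} S.X₁ Y n) := by
  refine subsingleton_of_forall_eq 0 fun x ↦ ?_
  obtain ⟨y, rfl⟩ := Ext.contravariant_sequence_exact₁ hS Y x (add_comm 1 n)
    (Subsingleton.elim _ _)
  rw [Subsingleton.elim y 0, Ext.comp_zero]

lemma subsingleton_ext_X₃_of_shortExact (hS : S.ShortExact) (Y : C) (n : ℕ)
    (h₂ : Subsingleton (Ext.{u} S.X₂ Y (n + 1))) (h₁ : Subsingleton (Ext.{u} S.X₁ Y n)) :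
    Subsingleton (Ext.{u} S.X₃ Y (n + 1)) := by
  refine subsingleton_of_forall_eq 0 fun x ↦ ?_
  obtain ⟨y, rfl⟩ := Ext.contravariant_sequence_exact₃ hS Y x
    (Subsingleton.elim _ _) (add_comm 1 n)
  rw [Subsingleton.elim y 0, Ext.comp_zero]

lemma subsingleton_ext_to_X₃_of_shortExact (hS : S.ShortExact) (Y : C) (n : ℕ)
    (h₂ : Subsingleton (Ext.{u} Y S.X₂ n)) (h₁ : Subsingleton (Ext.{u} Y S.X₁ (n + 1))) :
    Subsingleton (Ext.{u} Y S.X₃ n) := by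
  refine subsingleton_of_forall_eq 0 fun x ↦ ?_
  obtain ⟨y, rfl⟩ := Ext.covariant_sequence_exact₃ Y hS x rfl
    (Subsingleton.elim _ _)
  rw [Subsingleton.elim y 0, Ext.zero_comp]

lemma exists_extension_of_subsingleton_ext_one (hS : S.ShortExact) {Y : C}
    (h : Subsingleton (Ext.{u} S.X₃ Y 1)) (φ : S.X₁ ⟶ Y) : ∃ ψ : S.X₂ ⟶ Y, S.f ≫ ψ = φ := by
  obtain ⟨x, hx⟩ := Ext.contravariant_sequence_exact₁ hS Y (Ext.mk₀ φ) (add_zero 1)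
    (Subsingleton.elim _ _)
  obtain ⟨ψ, rfl⟩ := Ext.addEquiv₀.symm.surjective x
  refine ⟨ψ, (Ext.mk₀_bijective _ _).1 ?_⟩
  simpa using hx

lemma subsingleton_ext_one_of_exists_extension (hS : S.ShortExact) {Y : C}
    (h₂ : Subsingleton (Ext.{u} S.X₂ Y 1))
    (h : ∀ φ : S.X₁ ⟶ Y, ∃ ψ : S.X₂ ⟶ Y, S.f ≫ ψ = φ) :
    Subsingleton (Ext.{u} S.X₃ Y 1) := by
  refine subsingleton_of_forall_eq 0 fun x ↦ ?_
  obtain ⟨y, rfl⟩ := Ext.contravariant_sequence_exact₃ hS Y x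
    (Subsingleton.elim _ _) (add_zero 1)
  obtain ⟨φ, rfl⟩ := Ext.addEquiv₀.symm.surjective y
  obtain ⟨ψ, rfl⟩ := h φ
  simp [← Ext.mk₀_comp_mk₀]

lemma subsingleton_ext_one_of_exists_lift (hS : S.ShortExact) {Y : C}
    (h₂ : Subsingleton (Ext.{u} Y S.X₂ 1))
    (h : ∀ φ : Y ⟶ S.X₃, ∃ ψ : Y ⟶ S.X₂, ψ ≫ S.g = φ) :
    Subsingleton (Ext.{u} Y S.X₁ 1) := by
  refine subsingleton_of_forall_eq 0 fun x ↦ ?_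
  obtain ⟨y, rfl⟩ := Ext.covariant_sequence_exact₁ Y hS x
    (Subsingleton.elim _ _) (zero_add 1)
  obtain ⟨φ, rfl⟩ := Ext.addEquiv₀.symm.surjective y
  obtain ⟨ψ, rfl⟩ := h φ
  simp [← Ext.mk₀_comp_mk₀]

lemma ext1Vanishes_of_subsingleton {A B : C} (h : Subsingleton (Ext.{u} A B 1)) :
    Ext1Vanishes A B := by
  intro E f g w hS
  obtain ⟨x, hx⟩ := Ext.covariant_sequence_exact₃ A hS (Ext.mk₀ (𝟙 A)) (zero_add 1)
    (Subsingleton.elim _ _)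
  obtain ⟨s, rfl⟩ := Ext.addEquiv₀.symm.surjective x
  refine ⟨s, (Ext.mk₀_bijective _ _).1 ?_⟩
  simpa using hx

end ExtDimensionShift

lemma subsingleton_ext_one_of_ext1Vanishes {A B : ModuleCat.{u} R} (h : Ext1Vanishes A B) :
    Subsingleton (Ext.{u} A B 1) := by
  obtain ⟨J, _, i, _⟩ := EnoughInjectives.presentation B
  have hS : (ShortComplex.mk i (cokernel.π i) (cokernel.condition i)).ShortExact :=
    { exact := ShortComplex.exact_cokernel i }
  have hex := (ShortComplex.ShortExact.moduleCat_exact_iff_function_exact _).mp hS.exact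
  have hinj := hS.moduleCat_injective_f
  have hsurj := hS.moduleCat_surjective_g
  dsimp at hex hinj hsurj
  refine subsingleton_ext_one_of_exists_lift hS
    (Ext.subsingleton_of_injective _ _ _) fun φ ↦ ?_
  dsimp at φ ⊢
  let E := LinearMap.eqLocus (φ.hom ∘ₗ LinearMap.fst R A J)
    ((cokernel.π i).hom ∘ₗ LinearMap.snd R A J)
  let f : B →ₗ[R] E := LinearMap.codRestrict E (LinearMap.inr R A J ∘ₗ i.hom) fun b ↦ by
    have : (cokernel.π i) (i b) = 0 := (hex _).2 ⟨b, rfl⟩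
    simp [E, this]
  let g : E →ₗ[R] A := LinearMap.fst R A J ∘ₗ E.subtype
  have hgf : g ∘ₗ f = 0 := by ext; rfl
  obtain ⟨s, hs⟩ := h (ModuleCat.of R E) (ModuleCat.ofHom f) (ModuleCat.ofHom g)
    (by ext x; exact LinearMap.congr_fun hgf x) (by
      apply ModuleCat.shortComplex_shortExact
      · rintro ⟨⟨a, j⟩, he⟩
        constructor
        · intro (h0 : a = 0)
          subst h0
          have hj : (cokernel.π i) j = 0 := by
            have : φ 0 = (cokernel.π i) j := he
            rw [← this, map_zero]
          obtain ⟨b, rfl⟩ := (hex _).1 hj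
          exact ⟨b, rfl⟩
        · rintro ⟨b, hb⟩
          rw [← hb]
          exact LinearMap.congr_fun hgf b
      · intro a b hab
        exact hinj (congrArg (fun e : E ↦ e.1.2) hab)
      · intro a
        obtain ⟨j, hj⟩ := hsurj (φ a)
        exact ⟨⟨(a, j), hj.symm⟩, rfl⟩)
  refine ⟨s ≫ ModuleCat.ofHom (LinearMap.snd R A J ∘ₗ E.subtype), ?_⟩
  ext a
  have h1 : (s a : E).1.1 = a := congrArg (fun t : A ⟶ A ↦ t a) hs
  have h2 : φ (s a : E).1.1 = (cokernel.π i) (s a : E).1.2 := (s a : E).2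
  rw [h1] at h2
  exact h2.symm

section FiniteInjectiveDimension

lemma hasInjectiveDimensionLT_of_coresolution (n : ℕ) (M : ModuleCat.{u} R)
    (J : CochainComplex (ModuleCat.{u} R) ℕ) (ι : M ⟶ J.X 0)
    (hJ : ∀ i, Module.Injective R (J.X i)) (hn : ∀ i, n ≤ i → IsZero (J.X i)) (hι : Mono ι)
    (w : ι ≫ J.d 0 1 = 0) (h₀ : (ShortComplex.mk ι (J.d 0 1) w).Exact)
    (h : ∀ i, (ShortComplex.mk (J.d i (i + 1)) (J.d (i + 1) (i + 2))
      (J.d_comp_d i (i + 1) (i + 2))).Exact) :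
    HasInjectiveDimensionLT M n := by
  induction n generalizing M J with
  | zero => exact (IsZero.of_mono ι (hn 0 le_rfl)).hasInjectiveDimensionLT_zero
  | succ n ih =>
    have hS : (ShortComplex.mk ι (cokernel.π ι) (cokernel.condition ι)).ShortExact :=
      { exact := ShortComplex.exact_cokernel ι }
    have : Injective (J.X 0) := (Module.injective_iff_injective_object R _).1 (hJ 0)
    have hw : cokernel.desc ι (J.d 0 1) w ≫ J.d 1 2 = 0 := by
      rw [← cancel_epi (cokernel.π ι)]; simp
    have hd (x) : cokernel.desc ι (J.d 0 1) w (cokernel.π ι x) = J.d 0 1 x :=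
      ConcreteCategory.congr_hom (cokernel.π_desc ι (J.d 0 1) w) x
    have hJ0 : HasInjectiveDimensionLT (J.X 0) (n + 1) :=
      hasInjectiveDimensionLT_of_ge (J.X 0) 1 (n + 1) (by lia)
    refine hS.hasInjectiveDimensionLT_X₁ n ?_ hJ0
    refine ih _ (CochainComplex.truncate.obj J) (cokernel.desc ι (J.d 0 1) w)
      (fun i ↦ hJ (i + 1)) (fun i hi ↦ hn (i + 1) (by lia)) ?_ hw ?_ (fun i ↦ h (i + 1))
    · exact h₀.mono_cokernelDesc
    · have h1 := (ShortComplex.ShortExact.moduleCat_exact_iff_function_exact _).mp (h 0)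
      refine (ShortComplex.ShortExact.moduleCat_exact_iff_function_exact _).mpr fun y ↦ ?_
      refine (h1 y).trans ⟨?_, ?_⟩
      · rintro ⟨x, rfl⟩
        exact ⟨cokernel.π ι x, hd x⟩
      · rintro ⟨z, rfl⟩
        obtain ⟨x, rfl⟩ := hS.moduleCat_surjective_g z
        exact ⟨x, (hd x).symm⟩

open ZeroObject in
lemma hasFiniteInjectiveDimension_of_hasInjectiveDimensionLT (n : ℕ) (M : ModuleCat.{u} R)
    (hM : HasInjectiveDimensionLT M (n + 1)) : HasFiniteInjectiveDimension M := by
  induction n generalizing M with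
  | zero =>
    have hM0 : Injective M := injective_iff_hasInjectiveDimensionLT_one.2 hM
    have h0 (i) : IsZero ((0 : CochainComplex (ModuleCat.{u} R) ℕ).X i) :=
      Functor.map_isZero (HomologicalComplex.eval _ _ i) (isZero_zero _)
    refine ⟨0, CochainComplex.augment (C := 0) (0 : M ⟶ _) zero_comp, 𝟙 M, ?_, ?_,
      IsIso.mono_of_iso (𝟙 M), ?_, ?_, ?_⟩
    · rintro (_ | k)
      · exact (Module.injective_iff_injective_object R _).2 hM0
      · exact (Module.injective_iff_injective_object R _).2 (h0 k).injective
    · rintro (_ | k) hk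
      · lia
      · exact h0 k
    · exact comp_zero
    · refine (ShortComplex.exact_iff_epi _ rfl).2 ?_
      change Epi (𝟙 M)
      infer_instance
    · exact fun i ↦ ShortComplex.exact_of_isZero_X₂ _ (h0 i)
  | succ n ih =>
    obtain ⟨E, hE, i, hi⟩ := EnoughInjectives.presentation M
    have hS : (ShortComplex.mk i (cokernel.π i) (cokernel.condition i)).ShortExact :=
      { exact := ShortComplex.exact_cokernel i }
    obtain ⟨m, J, ι, hJ, hm, hι, w, h₀, h⟩ :=
      ih _ ((hS.hasInjectiveDimensionLT_X₃_iff n hE).2 hM)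
    have hiS := (ShortComplex.ShortExact.moduleCat_exact_iff_function_exact _).mp hS.exact
    have hιinj := (ModuleCat.mono_iff_injective ι).1 hι
    refine ⟨m + 1, J.augment (cokernel.π i ≫ ι) (by simp [w]), i, ?_, ?_, hi, ?_, ?_, ?_⟩
    · rintro (_ | k)
      · exact (Module.injective_iff_injective_object R _).2 hE
      · exact hJ k
    · rintro (_ | k) hk
      · lia
      · exact hm k (by lia)
    · exact (cokernel.condition_assoc i ι).trans zero_comp
    · refine (ShortComplex.ShortExact.moduleCat_exact_iff_function_exact _).mpr fun x ↦ ?_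
      refine Iff.trans ?_ (hiS x)
      change ι (cokernel.π i x) = 0 ↔ cokernel.π i x = 0
      exact map_eq_zero_iff _ hιinj
    · rintro (_ | k)
      · have h1 := (ShortComplex.ShortExact.moduleCat_exact_iff_function_exact _).mp h₀
        refine (ShortComplex.ShortExact.moduleCat_exact_iff_function_exact _).mpr fun y ↦ ?_
        refine (h1 y).trans ⟨?_, ?_⟩
        · rintro ⟨z, rfl⟩
          obtain ⟨x, rfl⟩ := hS.moduleCat_surjective_g z
          exact ⟨x, rfl⟩
        · rintro ⟨x, rfl⟩
          exact ⟨cokernel.π i x, rfl⟩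
      · exact h k

lemma hasFiniteInjectiveDimension_iff {M : ModuleCat.{u} R} :
    HasFiniteInjectiveDimension M ↔ ∃ n, HasInjectiveDimensionLT M n := by
  refine ⟨?_, fun ⟨n, h⟩ ↦ hasFiniteInjectiveDimension_of_hasInjectiveDimensionLT n M
    (hasInjectiveDimensionLT_of_ge M n (n + 1) (by lia))⟩
  rintro ⟨n, J, ι, hJ, hn, hι, w, h₀, h⟩
  exact ⟨n + 1, hasInjectiveDimensionLT_of_coresolution (n + 1) M J ι hJ
    (fun i hi ↦ hn i hi) hι w h₀ h⟩

end FiniteInjectiveDimension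

section Noetherian

open TensorProduct

lemma exists_comp_eq_of_ker_le_ker {A B I : Type u} [AddCommGroup A] [Module R A]
    [AddCommGroup B] [Module R B] [AddCommGroup I] [Module R I] [Module.Injective R I]
    (f : A →ₗ[R] B) (h : A →ₗ[R] I) (hfh : LinearMap.ker f ≤ LinearMap.ker h) :
    ∃ y : B →ₗ[R] I, y ∘ₗ f = h := by
  have hinj : Function.Injective ((LinearMap.ker f).liftQ f le_rfl) := by
    rw [← LinearMap.ker_eq_bot, Submodule.ker_liftQ_eq_bot _ _ _ le_rfl]
  obtain ⟨y, hy⟩ := Module.Injective.out _ hinj ((LinearMap.ker f).liftQ h hfh)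
  refine ⟨y, LinearMap.ext fun x ↦ ?_⟩
  simpa using hy (Submodule.Quotient.mk x)

lemma map_eq_sum_smul_map_single {ι M : Type*} [Fintype ι] [DecidableEq ι] [AddCommGroup M]
    [Module R M] (f : (ι → R) →ₗ[R] M) (v : ι → R) :
    f v = ∑ i, v i • f (Pi.single i 1) := by
  conv_lhs => rw [← LinearMap.sum_single_apply (φ := fun _ : ι ↦ R) v]
  simp_rw [map_sum, ← map_smul, ← Pi.single_smul, smul_eq_mul, mul_one]

lemma exists_eq_sum_tmul {ι M N : Type*} [Fintype ι] [AddCommGroup M] [Module R M]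
    [AddCommGroup N] [Module R N] [DecidableEq ι] (f : (ι → R) →ₗ[R] M)
    (hf : Function.Surjective f) (x : M ⊗[R] N) :
    ∃ y : ι → N, x = ∑ i, f (Pi.single i 1) ⊗ₜ[R] y i := by
  induction x with
  | zero => exact ⟨0, by simp⟩
  | tmul m n =>
    obtain ⟨v, rfl⟩ := hf m
    refine ⟨fun i ↦ v i • n, ?_⟩
    simp_rw [map_eq_sum_smul_map_single f v, TensorProduct.sum_tmul, TensorProduct.smul_tmul]
  | add x y hx hy =>
    obtain ⟨a, rfl⟩ := hx
    obtain ⟨b, rfl⟩ := hy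
    exact ⟨a + b, by simp [TensorProduct.tmul_add, Finset.sum_add_distrib]⟩

/-- If every functional on a finite submodule of `P` extends to `P`, then the inclusion stays
injective after tensoring with an injective module over a Noetherian ring. -/
lemma rTensor_injective_of_forall_exists_functional [IsNoetherianRing R] {L P I : Type u}
    [AddCommGroup L] [Module R L] [Module.Finite R L] [AddCommGroup P] [Module R P]
    [AddCommGroup I] [Module R I] [Module.Injective R I] (j : L →ₗ[R] P)
    (hj : ∀ φ : L →ₗ[R] R, ∃ ψ : P →ₗ[R] R, ψ ∘ₗ j = φ) :
    Function.Injective (j.rTensor I) := by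
  classical
  rw [injective_iff_map_eq_zero]
  intro x hx
  obtain ⟨b, f, hf⟩ := Module.Finite.exists_fin' R L
  obtain ⟨c, g, hg⟩ := Module.Finite.exists_fin' R (LinearMap.ker f)
  obtain ⟨y, rfl⟩ := exists_eq_sum_tmul f hf x
  let r : Fin c → Fin b → R := fun k ↦ (g (Pi.single k 1) : Fin b → R)
  have hr (k) : f (r k) = 0 := (g (Pi.single k 1)).2
  let A : (Fin b → R) →ₗ[R] (Fin c → R) :=
    LinearMap.pi fun k ↦ Fintype.linearCombination R (r k)
  let h : (Fin b → R) →ₗ[R] I := Fintype.linearCombination R y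
  have key : LinearMap.ker A ≤ LinearMap.ker h := by
    intro v hv
    have hv' (k) : ∑ i, v i * r k i = 0 := by
      simpa [A, Fintype.linearCombination_apply] using congrFun (LinearMap.mem_ker.1 hv) k
    let φ₀ : (Fin b → R) →ₗ[R] R := Fintype.linearCombination R v
    have hφ₀ : LinearMap.ker f ≤ LinearMap.ker φ₀ := by
      have : φ₀ ∘ₗ (LinearMap.ker f).subtype ∘ₗ g = 0 := by
        refine LinearMap.pi_ext' fun k ↦ LinearMap.ext_ring ?_
        simpa [φ₀, Fintype.linearCombination_apply, mul_comm] using hv' k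
      intro w hw
      obtain ⟨u, hu⟩ := hg ⟨w, hw⟩
      have := LinearMap.congr_fun this u
      simpa [hu] using this
    let φ : L →ₗ[R] R :=
      (LinearMap.ker f).liftQ φ₀ hφ₀ ∘ₗ (f.quotKerEquivOfSurjective hf).symm.toLinearMap
    have hφ (w) : φ (f w) = φ₀ w := by
      have : (f.quotKerEquivOfSurjective hf).symm (f w) = Submodule.Quotient.mk w := by
        rw [LinearEquiv.symm_apply_eq]; rfl
      simp [φ, this]
    obtain ⟨ψ, hψ⟩ := hj φ
    have h1 := congrArg (TensorProduct.lid R I ∘ ψ.rTensor I) hx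
    simp only [Function.comp_apply, map_sum, LinearMap.rTensor_tmul, TensorProduct.lid_tmul,
      map_zero] at h1
    have h2 (i) : ψ (j (f (Pi.single i 1))) = v i := by
      rw [← LinearMap.comp_apply, hψ, hφ]
      simp [φ₀, Fintype.linearCombination_apply_single]
    simpa [h2, h, Fintype.linearCombination_apply] using h1
  obtain ⟨z, hz⟩ := exists_comp_eq_of_ker_le_ker A h key
  have hy (i) : y i = ∑ k, r k i • z (Pi.single k 1) := by
    have := LinearMap.congr_fun hz (Pi.single i 1)
    rw [LinearMap.comp_apply, map_eq_sum_smul_map_single z] at this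
    simpa [A, h, Fintype.linearCombination_apply, Pi.single_apply] using this.symm
  calc ∑ i, f (Pi.single i 1) ⊗ₜ[R] y i
      = ∑ k, f (r k) ⊗ₜ[R] z (Pi.single k 1) := by
        simp_rw [hy, TensorProduct.tmul_sum]
        rw [Finset.sum_comm]
        refine Finset.sum_congr rfl fun k _ ↦ ?_
        simp_rw [map_eq_sum_smul_map_single f (r k), TensorProduct.sum_tmul,
          TensorProduct.smul_tmul]
    _ = 0 := by simp [hr]

lemma subsingleton_ext_one_characterModule [IsNoetherianRing R] (I : ModuleCat.{u} R)
    [Module.Injective R I] {S : ShortComplex (ModuleCat.{u} R)} (hS : S.ShortExact)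
    [Projective S.X₂] [Module.Finite R S.X₂]
    (h : Subsingleton (Ext.{u} S.X₃ (ModuleCat.of R R) 1)) :
    Subsingleton (Ext.{u} S.X₃ (ModuleCat.of R (CharacterModule I)) 1) := by
  have : Module.Finite R S.X₁ := Module.Finite.of_injective S.f.hom hS.moduleCat_injective_f
  have hinj : Function.Injective (S.f.hom.rTensor I) := by
    refine rTensor_injective_of_forall_exists_functional _ fun φ ↦ ?_
    obtain ⟨ψ, hψ⟩ := exists_extension_of_subsingleton_ext_one hS h (ModuleCat.ofHom φ)
    exact ⟨ψ.hom, congrArg ModuleCat.Hom.hom hψ⟩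
  refine subsingleton_ext_one_of_exists_extension hS (Ext.subsingleton_of_projective _ _ _)
    fun φ ↦ ?_
  obtain ⟨ψ, hψ⟩ := rTensor_injective_iff_lcomp_surjective.1 hinj φ.hom
  exact ⟨ModuleCat.ofHom ψ, ModuleCat.hom_ext hψ⟩

lemma exists_finite_projective_presentation (N : ModuleCat.{u} R) [Module.Finite R N] :
    ∃ S : ShortComplex (ModuleCat.{u} R), S.ShortExact ∧ Projective S.X₂ ∧
      Module.Finite R S.X₂ ∧ S.X₃ = N := by
  obtain ⟨P, _, _, _, _, f, hf⟩ := Module.exists_finite_presentation R N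
  exact ⟨f.shortComplexKer, LinearMap.shortExact_shortComplexKer hf,
    ModuleCat.projective_of_categoryTheory_projective (ModuleCat.of R P), ‹_›, rfl⟩

lemma subsingleton_ext_characterModule [IsNoetherianRing R] (I : ModuleCat.{u} R)
    [Module.Injective R I] (m : ℕ) (N : ModuleCat.{u} R) [Module.Finite R N]
    (h : Subsingleton (Ext.{u} N (ModuleCat.of R R) (m + 1))) :
    Subsingleton (Ext.{u} N (ModuleCat.of R (CharacterModule I)) (m + 1)) := by
  induction m generalizing N with
  | zero =>
    obtain ⟨S, hS, hP, hfin, rfl⟩ := exists_finite_projective_presentation N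
    exact subsingleton_ext_one_characterModule I hS h
  | succ m ih =>
    obtain ⟨S, hS, hP, hfin, rfl⟩ := exists_finite_projective_presentation N
    have : Module.Finite R S.X₁ := Module.Finite.of_injective S.f.hom hS.moduleCat_injective_f
    exact subsingleton_ext_X₃_of_shortExact hS _ _ (Ext.subsingleton_of_projective _ _ _)
      (ih _ (subsingleton_ext_X₁_of_shortExact hS _ _ (Ext.subsingleton_of_projective _ _ _) h))

lemma hasInjectiveDimensionLT_of_forall_ideal (n : ℕ) (X : ModuleCat.{u} R)
    (h : ∀ J : Ideal R, Subsingleton (Ext.{u} (ModuleCat.of R (R ⧸ J)) X (n + 1))) :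
    HasInjectiveDimensionLT X (n + 1) := by
  induction n generalizing X with
  | zero =>
    rw [zero_add, ← injective_iff_hasInjectiveDimensionLT_one,
      ← Module.injective_iff_injective_object R X]
    refine Module.Baer.injective fun J g ↦ ?_
    let S : ShortComplex (ModuleCat.{u} R) :=
      ModuleCat.shortComplexOfCompEqZero J.subtype J.mkQ
        (LinearMap.ext fun x ↦ (Submodule.Quotient.mk_eq_zero J).2 x.2)
    have hS : S.ShortExact := ModuleCat.shortComplex_shortExact S
      (LinearMap.exact_subtype_mkQ J) J.subtype_injective J.mkQ_surjective
    obtain ⟨ψ, hψ⟩ := exists_extension_of_subsingleton_ext_one hS (h J) (ModuleCat.ofHom g)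
    exact ⟨ψ.hom, fun x hx ↦ ConcreteCategory.congr_hom hψ (⟨x, hx⟩ : J)⟩
  | succ n ih =>
    obtain ⟨E, hE, i, hi⟩ := EnoughInjectives.presentation X
    have hS : (ShortComplex.mk i (cokernel.π i) (cokernel.condition i)).ShortExact :=
      { exact := ShortComplex.exact_cokernel i }
    exact (hS.hasInjectiveDimensionLT_X₃_iff n hE).1 (ih _ fun J ↦
      subsingleton_ext_to_X₃_of_shortExact hS _ _ (Ext.subsingleton_of_injective _ _ _) (h J))

lemma hasInjectiveDimensionLT_characterModule [IsNoetherianRing R] (n : ℕ)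
    (hn : HasInjectiveDimensionLT (ModuleCat.of R R) (n + 1)) (I : ModuleCat.{u} R)
    [Module.Injective R I] :
    HasInjectiveDimensionLT (ModuleCat.of R (CharacterModule I)) (n + 1) :=
  hasInjectiveDimensionLT_of_forall_ideal n _ fun J ↦
    subsingleton_ext_characterModule I n (ModuleCat.of R (R ⧸ J))
      (HasInjectiveDimensionLT.subsingleton _ (n + 1) _ le_rfl _)

end Noetherian

section FlatDimension

open TensorProduct

lemma CharacterModule.dual_exact {A B C : Type*} [AddCommGroup A] [Module R A]
    [AddCommGroup B] [Module R B] [AddCommGroup C] [Module R C] {f : A →ₗ[R] B} {g : B →ₗ[R] C}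
    (h : Function.Exact f g) (hg : Function.Surjective g) :
    Function.Exact (CharacterModule.dual g) (CharacterModule.dual f) := by
  intro χ
  constructor
  · intro hχ
    refine ⟨AddMonoidHom.liftOfSurjective g.toAddMonoidHom hg ⟨χ, fun b hb ↦ ?_⟩, ?_⟩
    · obtain ⟨a, rfl⟩ := (h b).1 hb
      exact DFunLike.congr_fun hχ a
    · ext b
      exact AddMonoidHom.liftOfRightInverse_comp_apply _ _ (Function.rightInverse_surjInv hg) _ b
  · rintro ⟨c, rfl⟩
    ext a
    change c (g (f a)) = 0
    rw [h.apply_apply_eq_zero, map_zero]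

/-- The character dual of a short complex of modules. -/
abbrev characterModuleDual (S : ShortComplex (ModuleCat.{u} R)) : ShortComplex (ModuleCat.{u} R) :=
  ModuleCat.shortComplexOfCompEqZero (CharacterModule.dual S.g.hom) (CharacterModule.dual S.f.hom)
    (by
      rw [← CharacterModule.dual_comp, ← ModuleCat.hom_comp, S.zero, ModuleCat.hom_zero,
        CharacterModule.dual_zero])

lemma shortExact_characterModuleDual {S : ShortComplex (ModuleCat.{u} R)} (hS : S.ShortExact) :
    (characterModuleDual S).ShortExact :=
  ModuleCat.shortComplex_shortExact _
    (CharacterModule.dual_exact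
      ((ShortComplex.ShortExact.moduleCat_exact_iff_function_exact _).1 hS.exact)
      hS.moduleCat_surjective_g)
    (CharacterModule.dual_injective_of_surjective _ hS.moduleCat_surjective_g)
    (CharacterModule.dual_surjective_of_injective _ hS.moduleCat_injective_f)

/-- The flat dimension of `M` is at most `k`, expressed as a bound on the injective dimension of
its character module. -/
def HasFlatDimensionLE (M : ModuleCat.{u} R) (k : ℕ) : Prop :=
  HasInjectiveDimensionLT (ModuleCat.of R (CharacterModule M)) (k + 1)

lemma hasFlatDimensionLE_zero_iff {M : ModuleCat.{u} R} :
    HasFlatDimensionLE M 0 ↔ Module.Flat R M := by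
  rw [Module.Flat.iff_characterModule_injective, HasFlatDimensionLE, zero_add,
    ← injective_iff_hasInjectiveDimensionLT_one, ← Module.injective_iff_injective_object]

lemma hasFlatDimensionLE_of_flat (M : ModuleCat.{u} R) [hM : Module.Flat R M] (k : ℕ) :
    HasFlatDimensionLE M k :=
  have : HasInjectiveDimensionLT (ModuleCat.of R (CharacterModule M)) (0 + 1) :=
    hasFlatDimensionLE_zero_iff.2 hM
  hasInjectiveDimensionLT_of_ge _ (0 + 1) _ (by lia)

lemma hasFlatDimensionLE_X₁ {S : ShortComplex (ModuleCat.{u} R)} (hS : S.ShortExact)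
    [Module.Flat R S.X₂] (k : ℕ) (h : HasFlatDimensionLE S.X₃ (k + 1)) :
    HasFlatDimensionLE S.X₁ k := by
  have hinj : Injective (characterModuleDual S).X₂ :=
    injective_iff_hasInjectiveDimensionLT_one.2 (hasFlatDimensionLE_of_flat S.X₂ 0)
  exact ((shortExact_characterModuleDual hS).hasInjectiveDimensionLT_X₃_iff k hinj).2 h

lemma flat_X₁_of_shortExact {S : ShortComplex (ModuleCat.{u} R)} (hS : S.ShortExact)
    [Module.Flat R S.X₂] [Module.Flat R S.X₃] : Module.Flat R S.X₁ :=
  hasFlatDimensionLE_zero_iff.1 (hasFlatDimensionLE_X₁ hS 0 (hasFlatDimensionLE_of_flat _ _))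

lemma isCotorsionModule_characterModule (X : ModuleCat.{u} R) :
    IsCotorsionModule (ModuleCat.of R (CharacterModule X)) := by
  intro F hF
  refine ext1Vanishes_of_subsingleton ?_
  have hS := F.shortExact_projectiveShortComplex
  have hP : Projective F.projectiveShortComplex.X₂ :=
    ModuleCat.projective_of_categoryTheory_projective _
  have hF' : Module.Flat R F.projectiveShortComplex.X₃ := hF
  have hinj : Function.Injective (F.projectiveShortComplex.f.hom.rTensor X) := by
    rw [← LinearMap.lTensor_inj_iff_rTensor_inj]
    exact LinearMap.lTensor_injective_of_exact_of_flat _ hS.moduleCat_surjective_g _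
      hS.moduleCat_injective_f
      ((ShortComplex.ShortExact.moduleCat_exact_iff_function_exact _).1 hS.exact) X
  refine subsingleton_ext_one_of_exists_extension hS (Ext.subsingleton_of_projective _ _ _)
    fun φ ↦ ?_
  obtain ⟨ψ, hψ⟩ := rTensor_injective_iff_lcomp_surjective.1 hinj φ.hom
  exact ⟨ModuleCat.ofHom ψ, ModuleCat.hom_ext hψ⟩

lemma IsCotorsionModule.subsingleton_ext {D : ModuleCat.{u} R} (hD : IsCotorsionModule D)
    (m : ℕ) (F : ModuleCat.{u} R) [hF : Module.Flat R F] :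
    Subsingleton (Ext.{u} F D (m + 1)) := by
  induction m generalizing F with
  | zero => exact subsingleton_ext_one_of_ext1Vanishes (hD F hF)
  | succ m ih =>
    have hS := F.shortExact_projectiveShortComplex
    have hP : Projective F.projectiveShortComplex.X₂ :=
      ModuleCat.projective_of_categoryTheory_projective _
    have hF' : Module.Flat R F.projectiveShortComplex.X₃ := hF
    have := flat_X₁_of_shortExact hS
    exact subsingleton_ext_X₃_of_shortExact hS _ _ (Ext.subsingleton_of_projective _ _ _) (ih _)

end FlatDimension

section AcyclicComplex

open TensorProduct

variable (F : ChainComplex (ModuleCat.{u} R) ℤ)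

lemma exactAt_iff_function_exact (i j k : ℤ) (hij : j + 1 = i) (hjk : k + 1 = j) :
    F.ExactAt j ↔ Function.Exact (F.d i j) (F.d j k) := by
  rw [F.exactAt_iff' i j k (by simp [hij]) (by simp [← hjk]),
    ShortComplex.ShortExact.moduleCat_exact_iff_function_exact]
  rfl

/-- The short complex `0 → Z_i → F_i → Z_j → 0` for `i = j + 1`, with cycles taken as kernels. -/
abbrev kerShortComplex (i j k : ℤ) : ShortComplex (ModuleCat.{u} R) :=
  ModuleCat.shortComplexOfCompEqZero (LinearMap.ker (F.d i j).hom).subtype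
    ((F.d i j).hom.codRestrict (LinearMap.ker (F.d j k).hom)
      fun x ↦ ConcreteCategory.congr_hom (F.d_comp_d i j k) x)
    (LinearMap.ext fun x ↦ Subtype.ext x.2)

variable {F}

lemma shortExact_kerShortComplex (hF : ∀ n, F.ExactAt n) (i j k : ℤ) (hij : j + 1 = i)
    (hjk : k + 1 = j) : (kerShortComplex F i j k).ShortExact := by
  have h := (exactAt_iff_function_exact F i j k hij hjk).1 (hF j)
  refine ModuleCat.shortComplex_shortExact _ ?_ (Submodule.subtype_injective _) ?_
  · intro x
    constructor
    · intro hx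
      exact ⟨⟨x, congrArg Subtype.val hx⟩, rfl⟩
    · rintro ⟨y, rfl⟩
      exact Subtype.ext y.2
  · rintro ⟨y, hy⟩
    obtain ⟨x, rfl⟩ := (h y).1 hy
    exact ⟨x, rfl⟩

variable (F) in
/-- The cycles of a complex of modules are the kernel of the differential. -/
noncomputable def cyclesIsoKer (j k : ℤ) (hjk : k + 1 = j) :
    F.cycles j ≅ ModuleCat.of R (LinearMap.ker (F.d j k).hom) :=
  F.cyclesIsoSc' (j + 1) j k (by simp) (by simp [← hjk]) ≪≫ (F.sc' (j + 1) j k).moduleCatCyclesIso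

lemma subsingleton_ext_ker (hX : ∀ n, Module.Flat R (F.X n)) (hF : ∀ n, F.ExactAt n)
    {D : ModuleCat.{u} R} (hD : IsCotorsionModule D) (d : ℕ) [HasInjectiveDimensionLT D d]
    (m : ℕ) (j k : ℤ) (hjk : k + 1 = j) :
    Subsingleton (Ext.{u} (ModuleCat.of R (LinearMap.ker (F.d j k).hom)) D (m + 1)) := by
  induction hr : d - m generalizing m j k with
  | zero => exact HasInjectiveDimensionLT.subsingleton D d _ (by lia) _
  | succ r ih =>
    have hXj := hX j
    exact subsingleton_ext_X₁_of_shortExact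
      (shortExact_kerShortComplex hF j k (k - 1) hjk (by lia)) D (m + 1)
      (hD.subsingleton_ext m (F.X j)) (ih (m + 1) k (k - 1) (by lia) (by lia))

lemma Ext1Vanishes.of_iso {C : Type*} [Category C] [Abelian C] {A A' B : C}
    (h : Ext1Vanishes A' B) (e : A ≅ A') : Ext1Vanishes A B := by
  intro E f g w hS
  have w' : f ≫ g ≫ e.hom = 0 := by rw [← Category.assoc, w, zero_comp]
  let α : ShortComplex.mk f g w ≅ ShortComplex.mk f (g ≫ e.hom) w' :=
    ShortComplex.isoMk (Iso.refl _) (Iso.refl _) e (by simp) (by simp)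
  obtain ⟨s, hs⟩ := h E f (g ≫ e.hom) w' (ShortComplex.shortExact_of_iso α hS)
  exact ⟨e.hom ≫ s, by
    rw [← cancel_mono e.hom, Category.assoc, Category.assoc, hs, Category.comp_id,
      Category.id_comp]⟩

lemma ext1Vanishes_of_isGorensteinFlat {D : ModuleCat.{u} R} (hD : IsCotorsionModule D)
    (d : ℕ) [HasInjectiveDimensionLT D d] (G : ModuleCat.{u} R) (hG : IsGorensteinFlat G) :
    Ext1Vanishes G D := by
  obtain ⟨F, ⟨hX, hF, -⟩, ⟨e⟩⟩ := hG
  have h := subsingleton_ext_ker hX hF hD d 0 0 (-1) (by lia)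
  exact (ext1Vanishes_of_subsingleton h).of_iso (e ≪≫ cyclesIsoKer F 0 (-1) (by lia))

/-- If character modules of injectives have finite injective dimension, then every acyclic complex
of flat modules is `F`-totally acyclic. -/
lemma fTotallyAcyclic_of_hasInjectiveDimensionLT_characterModule (n : ℕ)
    (hn : ∀ I : ModuleCat.{u} R, Module.Injective R I → HasFlatDimensionLE I n)
    (hX : ∀ n, Module.Flat R (F.X n)) (hF : ∀ n, F.ExactAt n) : FTotallyAcyclic F := by
  refine ⟨hX, hF, fun I hI j ↦ ?_⟩
  have hId := hn I hI
  unfold HasFlatDimensionLE at hId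
  have hS := shortExact_kerShortComplex hF (j - 1) (j - 1 - 1) (j - 1 - 1 - 1)
    (by lia) (by lia)
  have hinj : Function.Injective
      ((LinearMap.ker (F.d (j - 1) (j - 1 - 1)).hom).subtype.lTensor I) := by
    rw [LinearMap.lTensor_inj_iff_rTensor_inj, rTensor_injective_iff_lcomp_surjective]
    intro φ
    obtain ⟨ψ, hψ⟩ := exists_extension_of_subsingleton_ext_one hS
      (subsingleton_ext_ker hX hF (isCotorsionModule_characterModule I) (n + 1) 0 _ _ (by lia))
      (ModuleCat.ofHom φ)
    exact ⟨ψ.hom, congrArg ModuleCat.Hom.hom hψ⟩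
  have hT := shortExact_kerShortComplex hF j (j - 1) (j - 1 - 1) (by lia) (by lia)
  have hex : Function.Exact (F.d (j + 1) j).hom (kerShortComplex F j (j - 1) (j - 1 - 1)).g.hom := by
    intro x
    rw [← (exactAt_iff_function_exact F (j + 1) j (j - 1) rfl (by lia)).1 (hF j) x]
    exact Subtype.ext_iff
  have hten := lTensor_exact I hex hT.moduleCat_surjective_g
  rw [exactAt_iff_function_exact _ (j + 1) j (j - 1) rfl (by lia)]
  have hcomp : (F.d j (j - 1)).hom.lTensor I =
      (LinearMap.ker (F.d (j - 1) (j - 1 - 1)).hom).subtype.lTensor I ∘ₗ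
        (kerShortComplex F j (j - 1) (j - 1 - 1)).g.hom.lTensor I := by
    rw [← LinearMap.lTensor_comp]
    rfl
  have hten' : Function.Exact ((F.d (j + 1) j).hom.lTensor I) ((F.d j (j - 1)).hom.lTensor I) := by
    intro x
    rw [← hten x, hcomp, LinearMap.comp_apply, map_eq_zero_iff _ hinj]
  exact hten'

end AcyclicComplex

section FlatExtension

/-- There is a short exact sequence `0 → A → X → B → 0` with `X` flat. -/
def FlatExtension (A B : ModuleCat.{u} R) : Prop :=
  ∃ (X : ModuleCat.{u} R) (i : A ⟶ X) (p : X ⟶ B) (w : i ≫ p = 0),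
    Module.Flat R X ∧ (ShortComplex.mk i p w).ShortExact

lemma exists_int_sequence {α : Type*} (P : α → Prop) (r : α → α → Prop)
    (hl : ∀ a, P a → ∃ b, P b ∧ r b a) (hr : ∀ a, P a → ∃ b, P b ∧ r a b) (a : α) (ha : P a) :
    ∃ Z : ℤ → α, Z 1 = a ∧ ∀ n, r (Z (n + 1)) (Z n) := by
  choose! l hlP hl using hl
  choose! t htP ht using hr
  have hlk (k) : P (l^[k] a) := by
    induction k with
    | zero => exact ha
    | succ k ih => rw [Function.iterate_succ_apply']; exact hlP _ ih
  have htk (k) : P (t^[k] a) := by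
    induction k with
    | zero => exact ha
    | succ k ih => rw [Function.iterate_succ_apply']; exact htP _ ih
  let Z : ℤ → α := fun n ↦ match n with
    | Int.ofNat k => l^[k] a
    | Int.negSucc k => t^[k + 1] a
  have hZ (n) : r (Z (n + 1)) (Z n) := by
    match n with
    | Int.ofNat k =>
      change r (l^[k + 1] a) (l^[k] a)
      rw [Function.iterate_succ_apply']
      exact hl _ (hlk k)
    | Int.negSucc 0 => exact ht _ ha
    | Int.negSucc (k + 1) =>
      change r (t^[k + 1] a) (t^[k + 2] a)
      rw [Function.iterate_succ_apply' _ (k + 1)]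
      exact ht _ (htk (k + 1))
  refine ⟨fun n ↦ Z (n - 1), rfl, fun n ↦ ?_⟩
  have := hZ (n - 1)
  rwa [show n - 1 + 1 = n + 1 - 1 by lia] at this

lemma exists_acyclic_complex_of_flatExtension (Z : ℤ → ModuleCat.{u} R)
    (hZ : ∀ n, FlatExtension (Z (n + 1)) (Z n)) :
    ∃ F : ChainComplex (ModuleCat.{u} R) ℤ, (∀ n, Module.Flat R (F.X n)) ∧
      (∀ n, F.ExactAt n) ∧ Nonempty (Z 1 ≅ F.cycles 0) := by
  choose X i p w hX hS using hZ
  let F : ChainComplex (ModuleCat.{u} R) ℤ := ChainComplex.of X (fun n ↦ p (n + 1) ≫ i n)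
    (fun n ↦ by rw [Category.assoc, ← Category.assoc (i (n + 1)), w, zero_comp, comp_zero])
  have hd (n) : F.d (n + 1) n = p (n + 1) ≫ i n :=
    ChainComplex.of_d X (fun n ↦ p (n + 1) ≫ i n) n
  have hi (n) : Function.Injective (i n) := (hS n).moduleCat_injective_f
  have hp (n) : Function.Surjective (p n) := (hS n).moduleCat_surjective_g
  have hex (n) : Function.Exact (i n) (p n) :=
    (ShortComplex.ShortExact.moduleCat_exact_iff_function_exact _).1 (hS n).exact
  have hker (n) (x : X (n + 1)) : F.d (n + 1) n x = 0 ↔ p (n + 1) x = 0 := by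
    rw [hd]
    exact map_eq_zero_iff (i n).hom (hi n)
  refine ⟨F, hX, fun n ↦ ?_, ?_⟩
  · obtain ⟨m, rfl⟩ : ∃ m, m + 1 = n := ⟨n - 1, by lia⟩
    rw [exactAt_iff_function_exact F (m + 1 + 1) (m + 1) m rfl rfl]
    intro x
    rw [hker m x, hex (m + 1) x, hd]
    constructor
    · rintro ⟨z, rfl⟩
      obtain ⟨y, rfl⟩ := hp _ z
      exact ⟨y, rfl⟩
    · rintro ⟨y, rfl⟩
      exact ⟨p _ y, rfl⟩
  · have h : LinearMap.range (i (-1 + 1)).hom = LinearMap.ker (F.d (-1 + 1) (-1)).hom := by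
      ext x
      exact (hex _ x).symm.trans (hker (-1) x).symm
    exact ⟨((LinearEquiv.ofInjective (i (-1 + 1)).hom (hi _)).trans
      (LinearEquiv.ofEq _ _ h)).toModuleIso ≪≫ (cyclesIsoKer F (-1 + 1) (-1) rfl).symm⟩

lemma isGorensteinFlat_of_closed
    (hF : ∀ F : ChainComplex (ModuleCat.{u} R) ℤ, (∀ n, Module.Flat R (F.X n)) →
      (∀ n, F.ExactAt n) → FTotallyAcyclic F)
    (P : ModuleCat.{u} R → Prop) (hl : ∀ G, P G → ∃ G', P G' ∧ FlatExtension G' G)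
    (hr : ∀ G, P G → ∃ G', P G' ∧ FlatExtension G G') (G : ModuleCat.{u} R) (hG : P G) :
    IsGorensteinFlat G := by
  obtain ⟨Z, rfl, hZ⟩ := exists_int_sequence P FlatExtension hl hr G hG
  obtain ⟨F, hX, hex, e⟩ := exists_acyclic_complex_of_flatExtension Z hZ
  exact ⟨F, hF F hX hex, e⟩

lemma isGorensteinFlat_of_flat
    (hF : ∀ F : ChainComplex (ModuleCat.{u} R) ℤ, (∀ n, Module.Flat R (F.X n)) →
      (∀ n, F.ExactAt n) → FTotallyAcyclic F)
    (G : ModuleCat.{u} R) (hG : Module.Flat R G) : IsGorensteinFlat G := by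
  refine isGorensteinFlat_of_closed hF (fun G ↦ Module.Flat R G) (fun G hG ↦ ?_)
    (fun G hG ↦ ?_) G hG
  · have hS := G.shortExact_projectiveShortComplex
    have hG' : Module.Flat R G.projectiveShortComplex.X₃ := hG
    exact ⟨_, flat_X₁_of_shortExact hS, _, _, _, G.projectiveShortComplex.zero,
      inferInstance, hS⟩
  · refine ⟨ModuleCat.of R PUnit.{u + 1}, inferInstance, G, 𝟙 G, 0, comp_zero, hG, ?_⟩
    exact ModuleCat.shortComplex_shortExact _ (fun x ↦ ⟨fun _ ↦ ⟨x, rfl⟩, fun _ ↦ rfl⟩)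
      Function.injective_id (fun x ↦ ⟨0, rfl⟩)

end FlatExtension

section Syzygy

/-- There is a short exact sequence `0 → K → P → M → 0` with `P` projective. -/
def IsFirstSyzygy (M K : ModuleCat.{u} R) : Prop :=
  ∃ (P : ModuleCat.{u} R) (i : K ⟶ P) (p : P ⟶ M) (w : i ≫ p = 0),
    Projective P ∧ (ShortComplex.mk i p w).ShortExact

/-- `G` is a `k`-th syzygy of `M`. -/
def IsSyzygy : ℕ → ModuleCat.{u} R → ModuleCat.{u} R → Prop
  | 0, M, G => Nonempty (M ≅ G)
  | k + 1, M, G => ∃ K, IsFirstSyzygy M K ∧ IsSyzygy k K G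

lemma IsFirstSyzygy.flatExtension {M K : ModuleCat.{u} R} (h : IsFirstSyzygy M K) :
    FlatExtension K M := by
  obtain ⟨P, i, p, w, hP, hS⟩ := h
  have : Module.Projective R P := (IsProjective.iff_projective P).2 hP
  exact ⟨P, i, p, w, inferInstance, hS⟩

lemma exists_isFirstSyzygy (M : ModuleCat.{u} R) : ∃ K, IsFirstSyzygy M K :=
  ⟨_, _, _, _, M.projectiveShortComplex.zero,
    ModuleCat.projective_of_categoryTheory_projective _, M.shortExact_projectiveShortComplex⟩

lemma IsFirstSyzygy.of_iso {M M' K : ModuleCat.{u} R} (h : IsFirstSyzygy M K) (e : M ≅ M') :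
    IsFirstSyzygy M' K := by
  obtain ⟨P, i, p, w, hP, hS⟩ := h
  have w' : i ≫ p ≫ e.hom = 0 := by rw [← Category.assoc, w, zero_comp]
  let α : ShortComplex.mk i p w ≅ ShortComplex.mk i (p ≫ e.hom) w' :=
    ShortComplex.isoMk (Iso.refl _) (Iso.refl _) e (by simp) (by simp)
  exact ⟨P, i, p ≫ e.hom, w', hP, ShortComplex.shortExact_of_iso α hS⟩

lemma exists_isSyzygy (k : ℕ) (M : ModuleCat.{u} R) : ∃ G, IsSyzygy k M G := by
  induction k generalizing M with
  | zero => exact ⟨M, ⟨Iso.refl M⟩⟩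
  | succ k ih =>
    obtain ⟨K, hK⟩ := exists_isFirstSyzygy M
    obtain ⟨G, hG⟩ := ih K
    exact ⟨G, K, hK, hG⟩

lemma IsSyzygy.exists_succ {k : ℕ} {M G : ModuleCat.{u} R} (h : IsSyzygy k M G) :
    ∃ G', IsFirstSyzygy G G' ∧ IsSyzygy (k + 1) M G' := by
  induction k generalizing M with
  | zero =>
    obtain ⟨e⟩ := h
    obtain ⟨K, hK⟩ := exists_isFirstSyzygy M
    exact ⟨K, hK.of_iso e, K, hK, ⟨Iso.refl K⟩⟩
  | succ k ih =>
    obtain ⟨K, hK, hG⟩ := h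
    obtain ⟨G', hG', h'⟩ := ih hG
    exact ⟨G', hG', K, hK, h'⟩

lemma IsSyzygy.subsingleton_ext {k : ℕ} {M G D : ModuleCat.{u} R} (h : IsSyzygy k M G)
    (hG : Ext1Vanishes G D) : Subsingleton (Ext.{u} M D (k + 1)) := by
  induction k generalizing M with
  | zero =>
    obtain ⟨e⟩ := h
    exact subsingleton_ext_one_of_ext1Vanishes (hG.of_iso e)
  | succ k ih =>
    obtain ⟨K, ⟨P, i, p, w, hP, hS⟩, hK⟩ := h
    exact subsingleton_ext_X₃_of_shortExact hS D (k + 1)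
      (Ext.subsingleton_of_projective P D (k + 1)) (ih hK)

lemma exists_shortExact_isFirstSyzygy {S : ShortComplex (ModuleCat.{u} R)} (hS : S.ShortExact)
    {K : ModuleCat.{u} R} (hK : IsFirstSyzygy S.X₁ K) :
    ∃ T : ShortComplex (ModuleCat.{u} R), T.ShortExact ∧ T.X₁ = K ∧
      IsFirstSyzygy S.X₂ T.X₂ ∧ IsFirstSyzygy S.X₃ T.X₃ := by
  obtain ⟨P, j, u, w, hP, hT⟩ := hK
  let Q := S.X₂.projectiveShortComplex.X₂
  let v : Q →ₗ[R] S.X₂ := S.X₂.projectiveShortComplex.g.hom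
  have hv : Function.Surjective v := S.X₂.shortExact_projectiveShortComplex.moduleCat_surjective_g
  have hP' : Module.Projective R P := (IsProjective.iff_projective P).2 hP
  have hQ : Projective Q := ModuleCat.projective_of_categoryTheory_projective _
  have hPQ : Projective (ModuleCat.of R (P × Q)) :=
    (IsProjective.iff_projective _).1 inferInstance
  have hf : Function.Injective S.f := hS.moduleCat_injective_f
  have hg : Function.Surjective S.g := hS.moduleCat_surjective_g
  have hfg : Function.Exact S.f S.g :=
    (ShortComplex.ShortExact.moduleCat_exact_iff_function_exact _).1 hS.exact
  have hj : Function.Injective j := hT.moduleCat_injective_f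
  have hu : Function.Surjective u := hT.moduleCat_surjective_g
  have hju : Function.Exact j u :=
    (ShortComplex.ShortExact.moduleCat_exact_iff_function_exact _).1 hT.exact
  let a : (P × Q) →ₗ[R] S.X₂ := (S.f.hom ∘ₗ u.hom).coprod v
  let b : Q →ₗ[R] S.X₃ := S.g.hom ∘ₗ v
  have ha (x : P × Q) : a x = S.f (u x.1) + v x.2 := rfl
  have ha' : Function.Surjective a := fun y ↦ by
    obtain ⟨q, rfl⟩ := hv y
    exact ⟨(0, q), by simp [ha]⟩
  have hb' : Function.Surjective b := hg.comp hv
  let f : K →ₗ[R] LinearMap.ker a := (LinearMap.inl R P Q ∘ₗ j.hom).codRestrict _ fun x ↦ by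
    have : u (j x) = 0 := hju.apply_apply_eq_zero x
    simp [ha, this]
  let g : LinearMap.ker a →ₗ[R] LinearMap.ker b :=
    (LinearMap.snd R P Q ∘ₗ (LinearMap.ker a).subtype).codRestrict _ fun x ↦ by
      have h1 : S.f (u x.1.1) + v x.1.2 = 0 := x.2
      have h2 := congrArg S.g h1
      rw [map_add, hfg.apply_apply_eq_zero, zero_add, map_zero] at h2
      exact h2
  refine ⟨ModuleCat.shortComplexOfCompEqZero f g (LinearMap.ext fun _ ↦ rfl),
    ModuleCat.shortComplex_shortExact _ ?_ ?_ ?_, rfl,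
    ⟨ModuleCat.of R (P × Q), _, _, (LinearMap.shortComplexKer a).zero, hPQ,
      LinearMap.shortExact_shortComplexKer ha'⟩,
    ⟨Q, _, _, (LinearMap.shortComplexKer b).zero, hQ, LinearMap.shortExact_shortComplexKer hb'⟩⟩
  · rintro ⟨⟨x, q⟩, hx⟩
    constructor
    · intro hq
      obtain rfl : q = 0 := congrArg Subtype.val hq
      have h1 : S.f (u x) + v 0 = 0 := hx
      rw [map_zero, add_zero, map_eq_zero_iff S.f.hom hf] at h1
      obtain ⟨y, rfl⟩ := (hju x).1 h1
      exact ⟨y, rfl⟩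
    · rintro ⟨y, hy⟩
      rw [← hy]
      rfl
  · intro x y hxy
    exact hj (congrArg (fun z : LinearMap.ker a ↦ z.1.1) hxy)
  · rintro ⟨q, hq⟩
    obtain ⟨y, hy⟩ := (hfg (v q)).1 hq
    obtain ⟨x, rfl⟩ := hu y
    refine ⟨⟨(-x, q), ?_⟩, rfl⟩
    change S.f (u (-x)) + v q = 0
    rw [← hy, map_neg, map_neg, neg_add_cancel]

lemma IsFirstSyzygy.hasFlatDimensionLE {M K : ModuleCat.{u} R} (h : IsFirstSyzygy M K) (k : ℕ)
    (hM : HasFlatDimensionLE M (k + 1)) : HasFlatDimensionLE K k := by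
  obtain ⟨X, i, p, w, hX, hS⟩ := h.flatExtension
  exact hasFlatDimensionLE_X₁ hS k hM

lemma IsSyzygy.exists_flatExtension {k : ℕ} {S : ShortComplex (ModuleCat.{u} R)}
    (hS : S.ShortExact) {G : ModuleCat.{u} R} (h : IsSyzygy k S.X₁ G)
    (hk : HasFlatDimensionLE S.X₂ k) : ∃ H, IsSyzygy k S.X₃ H ∧ FlatExtension G H := by
  induction k generalizing S with
  | zero =>
    obtain ⟨e⟩ := h
    have w' : (e.inv ≫ S.f) ≫ S.g = 0 := by simp
    let α : S ≅ ShortComplex.mk (e.inv ≫ S.f) S.g w' :=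
      ShortComplex.isoMk e (Iso.refl _) (Iso.refl _) (by simp) (by simp)
    exact ⟨S.X₃, ⟨Iso.refl _⟩, S.X₂, _, _, w', hasFlatDimensionLE_zero_iff.1 hk,
      ShortComplex.shortExact_of_iso α hS⟩
  | succ k ih =>
    obtain ⟨K, hK, hG⟩ := h
    obtain ⟨T, hT, rfl, h₂, h₃⟩ := exists_shortExact_isFirstSyzygy hS hK
    obtain ⟨H, hH, hGH⟩ := ih hT hG (h₂.hasFlatDimensionLE k hk)
    exact ⟨H, ⟨_, h₃, hH⟩, hGH⟩

lemma IsSyzygy.isGorensteinFlat (n : ℕ)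
    (hn : ∀ I : ModuleCat.{u} R, Module.Injective R I → HasFlatDimensionLE I n)
    {M G : ModuleCat.{u} R} (h : IsSyzygy n M G) : IsGorensteinFlat G := by
  refine isGorensteinFlat_of_closed
    (fun _ ↦ fTotallyAcyclic_of_hasInjectiveDimensionLT_characterModule n hn)
    (fun G ↦ ∃ M, IsSyzygy n M G) ?_ ?_ G ⟨M, h⟩
  · rintro G ⟨M, h⟩
    obtain ⟨G', hG', K, -, hK⟩ := h.exists_succ
    exact ⟨G', ⟨K, hK⟩, hG'.flatExtension⟩
  · rintro G ⟨M, h⟩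
    obtain ⟨E, hE, i, hi⟩ := EnoughInjectives.presentation M
    have hS : (ShortComplex.mk i (cokernel.π i) (cokernel.condition i)).ShortExact :=
      { exact := ShortComplex.exact_cokernel i }
    obtain ⟨H, hH, hGH⟩ := IsSyzygy.exists_flatExtension hS h
      (hn E ((Module.injective_iff_injective_object R E).2 hE))
    exact ⟨H, ⟨_, hH⟩, hGH⟩

end Syzygy

end

theorem ext1_gorensteinFlat_vanishes_iff_cotorsion_and_finite_injective_dimension
    [IsNoetherianRing R]
    (hGor : HasFiniteInjectiveDimension (ModuleCat.of R R))
    (D : ModuleCat.{u} R) :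
    (∀ G : ModuleCat.{u} R, IsGorensteinFlat G → Ext1Vanishes G D) ↔
      (IsCotorsionModule D ∧ HasFiniteInjectiveDimension D) := by
  rw [hasFiniteInjectiveDimension_iff] at hGor ⊢
  obtain ⟨n, hR⟩ := hGor
  have hn (I : ModuleCat.{u} R) (hI : Module.Injective R I) : HasFlatDimensionLE I n :=
    hasInjectiveDimensionLT_characterModule n (hasInjectiveDimensionLT_of_ge _ n _ (by lia)) I
  constructor
  · intro h
    refine ⟨fun F hF ↦ h F (isGorensteinFlat_of_flat
      (fun _ ↦ fTotallyAcyclic_of_hasInjectiveDimensionLT_characterModule n hn) F hF), n + 1, ?_⟩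
    refine hasInjectiveDimensionLT_of_enoughProjectives D (n + 1) fun M ↦ ?_
    obtain ⟨G, hG⟩ := exists_isSyzygy n M
    exact hG.subsingleton_ext (h G (hG.isGorensteinFlat n hn))
  · rintro ⟨hD, d, hd⟩ G hG
    exact ext1Vanishes_of_isGorensteinFlat hD d G hG
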